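/- Let Θ ⊆ I, let w₁ ∈ W^Θ, w₂ ∈ ^{Θ∪Θ^⊥}W, and i ∈ I. Let (w₁'', w₂'') be the unique pair with w₁'' ∈ W^Θ, w₂'' ∈ ^{Θ∪Θ^⊥}W such that (σ_i w₁, w₂) ∼_Θ (w₁'', w₂''). Then: (a) if ℓ(σ_i w₁) = ℓ(w₁) + 1 and w₁⁻¹σ_i w₁ ∉ W_Θ, then ℓ(w₁'') + ℓ(w₂'') = ℓ(w₁) + ℓ(w₂) + 1; (b) if w₁⁻¹σ_i w₁ ∈ W_Θ, then ℓ(w₁'') + ℓ(w₂'') = ℓ(w₁) + ℓ(w₂); (c) if ℓ(σ_i w₁) = ℓ(w₁) − 1 and w₁⁻¹σ_i w₁ ∉ W_Θ, then ℓ(w₁'') + ℓ(w₂'') = ℓ(w₁) + ℓ(w₂) − 1. Moreover ℓ(w₁'') + ℓ(w₂'') = ℓ(w₁) + ℓ(w₂) if and only if (σ_i w₁, w₂) ∼_Θ (w₁, w₂). -/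

import Mathlib

open Classical

namespace Paper

variable {B : Type*} {M : CoxeterMatrix B} {W : Type*} [Group W]

/-- `Θ^⊥`: the indices whose simple reflections commute with all simple
reflections indexed by `Θ` (i.e. `m(i,j) = 2` for all `j ∈ Θ`). -/
def perp (M : CoxeterMatrix B) (Θ : Set B) : Set B := {i | i ∉ Θ ∧ ∀ j ∈ Θ, M i j = 2}

variable (cs : CoxeterSystem M W)

/-- The standard parabolic subgroup `W_J` generated by the simple reflections indexed by `J`. -/
def parabolic (J : Set B) : Subgroup W := Subgroup.closure (cs.simple '' J)

/-- `W^J`: the minimal-length representatives of the cosets `W/W_J`,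
`{w : ℓ(wu) = ℓ(w) + ℓ(u) for all u ∈ W_J}`. -/
def minRight (J : Set B) : Set W :=
  {w | ∀ u ∈ parabolic cs J, cs.length (w * u) = cs.length w + cs.length u}

/-- `^JW`: the minimal-length representatives of the cosets `W_J\W`,
`{w : ℓ(uw) = ℓ(u) + ℓ(w) for all u ∈ W_J}`. -/
def minLeft (J : Set B) : Set W :=
  {w | ∀ u ∈ parabolic cs J, cs.length (u * w) = cs.length u + cs.length w}

/-- The Bruhat order on `W`: `x ≤ y` iff `y` is obtained from `x` by a chain of
right multiplications by reflections, each strictly increasing the length. -/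
def bruhatLE : W → W → Prop :=
  Relation.ReflTransGen (fun x y => ∃ t, cs.IsReflection t ∧ y = x * t ∧ cs.length x < cs.length y)

/-- The equivalence relation `∼_Θ` on `W × W`:
`(x,y) ∼_Θ (x',y')` iff there are `u ∈ W_{Θ∪Θ^⊥}` and `v ∈ W_Θ` with `x' = xu`, `y' = u⁻¹vy`. -/
def simRel (Θ : Set B) (p q : W × W) : Prop :=
  ∃ u ∈ parabolic cs (Θ ∪ perp M Θ), ∃ v ∈ parabolic cs Θ,
    q.1 = p.1 * u ∧ q.2 = u⁻¹ * v * p.2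

/-- `w^J`: the minimal-length element of the coset `w W_J`. -/
noncomputable def projR (J : Set B) (w : W) : W :=
  if h : ∃ a, a ∈ minRight cs J ∧ a⁻¹ * w ∈ parabolic cs J then h.choose else w

/-- `^Jw`: the minimal-length element of the coset `W_J w`. -/
noncomputable def projL (J : Set B) (w : W) : W :=
  if h : ∃ a, a ∈ minLeft cs J ∧ w * a⁻¹ ∈ parabolic cs J then h.choose else w

/-- The permutation `(t, ε) ↦ (sᵢ t sᵢ, ε + [t = sᵢ])` of `W × ℤ/2`. -/
noncomputable def signedConj (i : B) : Equiv.Perm (W × ZMod 2) :=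
  Function.Involutive.toPerm
    (fun p => (cs.simple i * p.1 * cs.simple i, p.2 + if p.1 = cs.simple i then 1 else 0)) <| by
    rintro ⟨t, ε⟩
    have h : cs.simple i * t * cs.simple i = cs.simple i ↔ t = cs.simple i := by
      constructor
      · intro h
        simpa [mul_assoc] using congrArg (fun x => cs.simple i * x * cs.simple i) h
      · rintro rfl
        simp
    ext
    · simp [mul_assoc]
    · simp only [h, add_assoc, CharTwo.add_self_eq_zero, add_zero]

theorem signedConj_apply (i : B) (t : W) (ε : ZMod 2) :
    signedConj cs i (t, ε) =
      (cs.simple i * t * cs.simple i, ε + if t = cs.simple i then 1 else 0) := rfl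

theorem inv_pow_mul_simple (i j : B) (k : ℕ) :
    ((cs.simple i * cs.simple j) ^ k)⁻¹ * cs.simple j =
      cs.simple j * (cs.simple i * cs.simple j) ^ k := by
  induction k with
  | zero => simp
  | succ k ih =>
    rw [pow_succ, mul_inv_rev, mul_assoc, ih, ← pow_succ, pow_succ']
    simp [mul_assoc]

theorem signedConj_mul_pow_apply (i j : B) (k : ℕ) (t : W) (ε : ZMod 2) :
    ((signedConj cs i * signedConj cs j) ^ k) (t, ε) =
      ((cs.simple i * cs.simple j) ^ k * t * ((cs.simple i * cs.simple j) ^ k)⁻¹,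
        ε + ∑ l ∈ Finset.range (2 * k),
          if t = cs.simple j * (cs.simple i * cs.simple j) ^ l then 1 else 0) := by
  induction k with
  | zero => simp
  | succ k ih =>
    have hp := inv_pow_mul_simple cs i j k
    set p := cs.simple i * cs.simple j with hpdef
    have h1 : p ^ k * t * (p ^ k)⁻¹ = cs.simple j ↔ t = cs.simple j * p ^ (2 * k) := by
      rw [mul_inv_eq_iff_eq_mul, ← eq_inv_mul_iff_mul_eq, ← mul_assoc, hp, mul_assoc, ← pow_add,
        two_mul]
    have h2 : cs.simple j * (p ^ k * t * (p ^ k)⁻¹) * cs.simple j = cs.simple i ↔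
        t = cs.simple j * p ^ (2 * k + 1) := by
      have : cs.simple j * (p ^ k * t * (p ^ k)⁻¹) * cs.simple j = cs.simple i ↔
          p ^ k * t * (p ^ k)⁻¹ = cs.simple j * p := by
        rw [hpdef, ← cs.inv_simple j, mul_inv_eq_iff_eq_mul, inv_mul_eq_iff_eq_mul,
          cs.inv_simple j]
      rw [this, mul_inv_eq_iff_eq_mul, ← eq_inv_mul_iff_mul_eq, ← mul_assoc, ← mul_assoc, hp,
        mul_assoc, mul_assoc, ← pow_succ', ← pow_add]
      congr! 3
      ring
    rw [pow_succ', Equiv.Perm.mul_apply, ih, Equiv.Perm.mul_apply, signedConj_apply,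
      signedConj_apply]
    ext
    · simp only [pow_succ', mul_inv_rev]
      simp [hpdef, mul_assoc]
    · simp only [h1, h2, Nat.mul_succ, Finset.sum_range_succ, add_assoc]

theorem isLiftable_signedConj : M.IsLiftable (signedConj cs) := by
  intro i j
  ext1 ⟨t, ε⟩
  rw [signedConj_mul_pow_apply, two_mul, Finset.sum_range_add]
  simp only [pow_add, cs.simple_mul_simple_pow, one_mul, CharTwo.add_self_eq_zero]
  simp

/-- The action of `W` on `W × ℤ/2` whose second component records the parity of the number of
occurrences of an element in the right inversion sequence of a word. -/
noncomputable def signedConjHom : W →* Equiv.Perm (W × ZMod 2) :=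
  cs.lift ⟨signedConj cs, isLiftable_signedConj cs⟩

theorem signedConjHom_simple (i : B) : signedConjHom cs (cs.simple i) = signedConj cs i :=
  cs.lift_apply_simple _ _

theorem signedConjHom_wordProd_apply (ω : List B) (t : W) (ε : ZMod 2) :
    signedConjHom cs (cs.wordProd ω) (t, ε) =
      (cs.wordProd ω * t * (cs.wordProd ω)⁻¹, ε + ((cs.rightInvSeq ω).count t : ZMod 2)) := by
  induction ω with
  | nil => simp
  | cons i ω ih =>
    have h : cs.wordProd ω * t * (cs.wordProd ω)⁻¹ = cs.simple i ↔
        (cs.wordProd ω)⁻¹ * cs.simple i * cs.wordProd ω = t := by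
      rw [mul_inv_eq_iff_eq_mul, ← eq_inv_mul_iff_mul_eq, ← mul_assoc, eq_comm]
    rw [cs.wordProd_cons, map_mul, Equiv.Perm.mul_apply, ih, signedConjHom_simple,
      signedConj_apply]
    ext
    · simp [mul_assoc]
    · simp [CoxeterSystem.rightInvSeq, List.count_cons, h, add_assoc]

/-- The strong exchange property, for simple reflections: a right descent of the product of a word,
reduced or not, occurs in the right inversion sequence of that word. -/
theorem simple_mem_rightInvSeq {ω : List B} {i : B}
    (h : cs.IsRightDescent (cs.wordProd ω) i) : cs.simple i ∈ cs.rightInvSeq ω := by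
  by_contra hω
  obtain ⟨ω', hred, hω'⟩ := cs.exists_isReduced (cs.wordProd ω * cs.simple i)
  have key := congrArg Prod.snd (signedConjHom_wordProd_apply cs ω' (cs.simple i) 0)
  rw [← hω', map_mul, Equiv.Perm.mul_apply, signedConjHom_simple, signedConj_apply] at key
  simp only [cs.simple_mul_simple_self, one_mul, if_true, zero_add, signedConjHom_wordProd_apply,
    List.count_eq_zero_of_not_mem hω, Nat.cast_zero, add_zero] at key
  have hmem : cs.simple i ∈ cs.rightInvSeq ω' := by
    by_contra hn
    simp [List.count_eq_zero_of_not_mem hn] at key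
  have hinv := (cs.isRightInversion_of_mem_rightInvSeq hred hmem).2
  rw [← hω', cs.simple_mul_simple_cancel_right] at hinv
  exact lt_asymm h hinv

theorem simple_mem_leftInvSeq {ω : List B} {i : B}
    (h : cs.IsLeftDescent (cs.wordProd ω) i) : cs.simple i ∈ cs.leftInvSeq ω := by
  rw [← cs.isRightDescent_inv_iff, ← cs.wordProd_reverse] at h
  simpa [cs.rightInvSeq_reverse] using simple_mem_rightInvSeq cs h

theorem leftInvSeq_append (ω ω' : List B) :
    cs.leftInvSeq (ω ++ ω') =
      cs.leftInvSeq ω ++ (cs.leftInvSeq ω').map (MulAut.conj (cs.wordProd ω)) := by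
  induction ω with
  | nil => simp
  | cons i ω ih => simp [CoxeterSystem.leftInvSeq, ih, cs.wordProd_cons]

theorem simple_mem_parabolic {J : Set B} {j : B} (hj : j ∈ J) : cs.simple j ∈ parabolic cs J :=
  Subgroup.subset_closure ⟨j, hj, rfl⟩

theorem parabolic_mono {J K : Set B} (h : J ⊆ K) : parabolic cs J ≤ parabolic cs K :=
  Subgroup.closure_mono (Set.image_mono h)

theorem mem_parabolic_of_mem_leftInvSeq {J : Set B} {ω : List B} (hω : ∀ j ∈ ω, j ∈ J) {t : W}
    (ht : t ∈ cs.leftInvSeq ω) : t ∈ parabolic cs J := by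
  induction ω generalizing t with
  | nil => simp at ht
  | cons i ω ih =>
    have hi := simple_mem_parabolic cs (hω i (by simp))
    simp only [CoxeterSystem.leftInvSeq, List.mem_cons, List.mem_map] at ht
    obtain rfl | ⟨t, ht, rfl⟩ := ht
    · exact hi
    · exact mul_mem (mul_mem hi (ih (fun j hj => hω j (by simp [hj])) ht)) (inv_mem hi)

theorem exists_word_of_mem_parabolic {J : Set B} {u : W} (hu : u ∈ parabolic cs J) :
    ∃ ω : List B, (∀ j ∈ ω, j ∈ J) ∧ u = cs.wordProd ω := by
  induction hu using Subgroup.closure_induction with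
  | mem x hx =>
    obtain ⟨j, hj, rfl⟩ := hx
    exact ⟨[j], by simpa using hj, by simp⟩
  | one => exact ⟨[], by simp, by simp⟩
  | mul x y _ _ hx hy =>
    obtain ⟨ω, hω, rfl⟩ := hx
    obtain ⟨ω', hω', rfl⟩ := hy
    exact ⟨ω ++ ω', by simpa [or_imp, forall_and] using ⟨hω, hω'⟩, by simp [cs.wordProd_append]⟩
  | inv x _ hx =>
    obtain ⟨ω, hω, rfl⟩ := hx
    exact ⟨ω.reverse, by simpa using hω, by simp⟩

/-- Deodhar's lemma: if `w` is minimal in `w W_J` and `sᵢ w W_J ≠ w W_J`, then `sᵢ w` is minimal in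
its coset. -/
theorem simple_mul_mem_minRight {J : Set B} {w : W} {i : B} (hw : w ∈ minRight cs J)
    (hi : w⁻¹ * cs.simple i * w ∉ parabolic cs J) : cs.simple i * w ∈ minRight cs J := by
  intro u hu
  have hwu := hw u hu
  have hle := cs.length_mul_le (cs.simple i * w) u
  rw [mul_assoc] at hle ⊢
  rcases cs.length_simple_mul w i with h | h
  · rcases cs.length_simple_mul (w * u) i with h' | h'
    · omega
    · exfalso
      obtain ⟨ω, hred, rfl⟩ := cs.exists_isReduced w
      obtain ⟨ω', hω', rfl⟩ := exists_word_of_mem_parabolic cs hu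
      have hdesc : cs.IsLeftDescent (cs.wordProd (ω ++ ω')) i := by
        rw [cs.wordProd_append]
        exact cs.isLeftDescent_iff.2 h'
      have hmem := simple_mem_leftInvSeq cs hdesc
      rw [leftInvSeq_append, List.mem_append, List.mem_map] at hmem
      obtain hmem | ⟨t, ht, hti⟩ := hmem
      · have := (cs.isLeftInversion_of_mem_leftInvSeq hred hmem).2
        omega
      · apply hi
        rw [← hti]
        simpa [mul_assoc] using mem_parabolic_of_mem_leftInvSeq cs hω' ht
  · rcases cs.length_simple_mul (w * u) i with h' | h' <;> omega

theorem eq_one_of_mul_mem_minRight {J : Set B} {w u : W} (hu : u ∈ parabolic cs J)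
    (hw : w ∈ minRight cs J) (hwu : w * u ∈ minRight cs J) : u = 1 := by
  have h := hw u hu
  have h' := hwu u⁻¹ (inv_mem hu)
  rw [mul_inv_cancel_right] at h'
  exact cs.length_eq_zero_iff.1 (by omega)

theorem eq_one_of_mul_mem_minLeft {J : Set B} {w u : W} (hu : u ∈ parabolic cs J)
    (hw : w ∈ minLeft cs J) (huw : u * w ∈ minLeft cs J) : u = 1 := by
  have h := hw u hu
  have h' := huw u⁻¹ (inv_mem hu)
  rw [inv_mul_cancel_left] at h'
  exact cs.length_eq_zero_iff.1 (by omega)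

/-- Uniqueness of the normal form of a `∼_Θ`-class. -/
theorem simRel.eq_of_normal {Θ : Set B} {x y x' y' : W} (h : simRel cs Θ (x, y) (x', y'))
    (hx : x ∈ minRight cs Θ) (hy : y ∈ minLeft cs (Θ ∪ perp M Θ))
    (hx' : x' ∈ minRight cs Θ) (hy' : y' ∈ minLeft cs (Θ ∪ perp M Θ)) : x' = x ∧ y' = y := by
  obtain ⟨u, hu, v, hv, rfl, rfl⟩ := h
  have hv' := parabolic_mono cs (J := Θ) (K := Θ ∪ perp M Θ) Set.subset_union_left hv
  have huv := eq_one_of_mul_mem_minLeft cs (mul_mem (inv_mem hu) hv') hy hy'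
  obtain rfl : u = v := inv_mul_eq_one.1 huv
  obtain rfl := eq_one_of_mul_mem_minRight cs hv hx hx'
  simp

theorem simRel_simple_mul_iff {Θ : Set B} {x y : W} {i : B}
    (hy : y ∈ minLeft cs (Θ ∪ perp M Θ)) :
    simRel cs Θ (cs.simple i * x, y) (x, y) ↔ x⁻¹ * cs.simple i * x ∈ parabolic cs Θ := by
  have hsub := parabolic_mono cs (J := Θ) (K := Θ ∪ perp M Θ) Set.subset_union_left
  constructor
  · rintro ⟨u, hu, v, hv, hux, huy⟩
    dsimp only at hux huy
    have huv := eq_one_of_mul_mem_minLeft cs (mul_mem (inv_mem hu) (hsub hv)) hy (huy ▸ hy)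
    obtain rfl : u = v := inv_mul_eq_one.1 huv
    have : x⁻¹ * cs.simple i * x = u⁻¹ := by
      rw [eq_inv_iff_mul_eq_one, mul_assoc, mul_assoc, ← mul_assoc (cs.simple i), ← hux,
        inv_mul_cancel]
    exact this ▸ inv_mem hv
  · intro h
    exact ⟨_, hsub (inv_mem h), _, inv_mem h, by simp [mul_assoc], by simp [mul_assoc]⟩

theorem simRel.simple_mul_cancel {Θ : Set B} {x y : W} {q : W × W} {i : B}
    (h : simRel cs Θ (cs.simple i * x, y) q) (hi : x⁻¹ * cs.simple i * x ∈ parabolic cs Θ) :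
    simRel cs Θ (x, y) q := by
  obtain ⟨u, hu, v, hv, h1, h2⟩ := h
  refine ⟨_, mul_mem (parabolic_mono cs Set.subset_union_left hi) hu, _, mul_mem hi hv, ?_, ?_⟩
  · simp [h1, mul_assoc]
  · simp [h2, mul_assoc]

/-- behaviour of the extended length `l₋₊ = ℓ(w₁) + ℓ(w₂)` under
left multiplication by a simple reflection `σ_i`. -/
theorem statement14 [Finite B] (Θ : Set B) (w₁ w₂ : W) (i : B)
    (h₁ : w₁ ∈ minRight cs Θ) (h₂ : w₂ ∈ minLeft cs (Θ ∪ perp M Θ))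
    (w₁'' w₂'' : W)
    (h₁'' : w₁'' ∈ minRight cs Θ) (h₂'' : w₂'' ∈ minLeft cs (Θ ∪ perp M Θ))
    (hsim : simRel cs Θ (cs.simple i * w₁, w₂) (w₁'', w₂'')) :
    ((cs.length (cs.simple i * w₁) = cs.length w₁ + 1 →
        w₁⁻¹ * cs.simple i * w₁ ∉ parabolic cs Θ →
        cs.length w₁'' + cs.length w₂'' = cs.length w₁ + cs.length w₂ + 1) ∧
      (w₁⁻¹ * cs.simple i * w₁ ∈ parabolic cs Θ →
        cs.length w₁'' + cs.length w₂'' = cs.length w₁ + cs.length w₂) ∧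
      (cs.length (cs.simple i * w₁) + 1 = cs.length w₁ →
        w₁⁻¹ * cs.simple i * w₁ ∉ parabolic cs Θ →
        cs.length w₁'' + cs.length w₂'' + 1 = cs.length w₁ + cs.length w₂)) ∧
    (cs.length w₁'' + cs.length w₂'' = cs.length w₁ + cs.length w₂ ↔
      simRel cs Θ (cs.simple i * w₁, w₂) (w₁, w₂)) := by
  rw [simRel_simple_mul_iff cs h₂]
  by_cases hi : w₁⁻¹ * cs.simple i * w₁ ∈ parabolic cs Θ
  · obtain ⟨rfl, rfl⟩ := (hsim.simple_mul_cancel cs hi).eq_of_normal cs h₁ h₂ h₁'' h₂''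
    simp [hi]
  · obtain ⟨rfl, rfl⟩ :=
      hsim.eq_of_normal cs (simple_mul_mem_minRight cs h₁ hi) h₂ h₁'' h₂''
    have hne := cs.length_simple_mul_ne w₁ i
    simp only [hi, not_false_eq_true, false_imp_iff, true_imp_iff, iff_false, true_and]
    omega

end Paper
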